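/- Let a > 0 and let V : ℝ → ℝ be real-analytic, a-periodic and even (V(−x) = V(x) for all x). Let λ < μ be real numbers and let f, g be periodic eigenfunctions of L = −d²/dx² − V for λ and μ respectively, both satisfying f(0) = 0 and g(0) = 0 (so both are odd functions of x). If f has n zeros in [0,a) and g has m zeros in [0,a), then m ≥ n + 2. -/

import Mathlib

/-- `f` is a periodic eigenfunction of `L = -d²/dx² - V` with eigenvalue `lam`. -/
def IsPeriodicEigenfunction (a : ℝ) (V : ℝ → ℝ) (lam : ℝ) (f : ℝ → ℝ) : Prop :=
  ContDiff ℝ (⊤ : ℕ∞) f ∧ f ≠ 0 ∧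
    (∀ x : ℝ, deriv (deriv f) x + (V x + lam) * f x = 0) ∧ ∀ x : ℝ, f (x + a) = f x

open Filter Topology

/-- A solution of `h'' + q h = 0` with bounded `q` and vanishing Cauchy data at a point
is identically zero. -/
theorem eq_zero_of_linear_ode_of_cauchy_data {q h h' : ℝ → ℝ} {M : ℝ} (hq : ∀ t, |q t| ≤ M)
    (hh : ∀ t, HasDerivAt h (h' t) t) (hh' : ∀ t, HasDerivAt h' (-(q t * h t)) t)
    {t₀ : ℝ} (h0 : h t₀ = 0) (h0' : h' t₀ = 0) (t : ℝ) : h t = 0 := by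
  have hM : 0 ≤ M := (abs_nonneg _).trans (hq 0)
  have key := ODE_solution_unique_univ (E := ℝ × ℝ)
    (v := fun t p => (p.2, -(q t * p.1))) (s := fun _ => Set.univ)
    (K := ⟨max 1 M, le_max_of_le_left zero_le_one⟩)
    (f := fun t => (h t, h' t)) (g := fun _ => 0) (t₀ := t₀)
    (fun t => by
      refine LipschitzWith.lipschitzOnWith (LipschitzWith.of_dist_le_mul fun x y => ?_)
      have h1 : |x.1 - y.1| ≤ dist x y := by
        rw [Prod.dist_eq, Real.dist_eq, Real.dist_eq]; exact le_max_left _ _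
      have h2 : |x.2 - y.2| ≤ dist x y := by
        rw [Prod.dist_eq, Real.dist_eq, Real.dist_eq]; exact le_max_right _ _
      change max (dist x.2 y.2) (dist (-(q t * x.1)) (-(q t * y.1))) ≤ max 1 M * dist x y
      rw [Real.dist_eq, Real.dist_eq]
      refine max_le ?_ ?_
      · calc |x.2 - y.2| ≤ 1 * dist x y := by simpa using h2
          _ ≤ _ := by gcongr; exact le_max_left _ _
      · calc |-(q t * x.1) - -(q t * y.1)| = |q t| * |x.1 - y.1| := by
              rw [← abs_mul, ← abs_neg]; ring_nf
          _ ≤ max 1 M * dist x y := by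
              gcongr
              exact (hq t).trans (le_max_right _ _))
    (fun t => ⟨(hh t).prodMk (hh' t), trivial⟩)
    (fun t => ⟨(hasDerivAt_const t (0 : ℝ × ℝ)).congr_deriv (by simp; rfl), trivial⟩)
    (by simp [h0, h0'])
  have := congrFun key t
  simpa using congrArg Prod.fst this

/-- A function vanishing at `x` and positive just to the right has nonnegative derivative. -/
theorem HasDerivAt.nonneg_of_pos_right {f : ℝ → ℝ} {f' x y : ℝ} (hf : HasDerivAt f f' x)
    (hxy : x < y) (hx : f x = 0) (hpos : ∀ t ∈ Set.Ioo x y, 0 < f t) : 0 ≤ f' := by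
  have h := (hasDerivWithinAt_iff_tendsto_slope' (s := Set.Ioi x) (by simp)).1
    hf.hasDerivWithinAt
  refine ge_of_tendsto h ?_
  filter_upwards [Ioo_mem_nhdsGT hxy] with t ht
  rw [slope_def_field, hx, sub_zero]
  exact div_nonneg (hpos t ht).le (sub_nonneg.2 ht.1.le)

/-- A function vanishing at `y` and positive just to the left has nonpositive derivative. -/
theorem HasDerivAt.nonpos_of_pos_left {f : ℝ → ℝ} {f' x y : ℝ} (hf : HasDerivAt f f' y)
    (hxy : x < y) (hy : f y = 0) (hpos : ∀ t ∈ Set.Ioo x y, 0 < f t) : f' ≤ 0 := by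
  have h := (hasDerivWithinAt_iff_tendsto_slope' (s := Set.Iio y) (by simp)).1
    hf.hasDerivWithinAt
  refine le_of_tendsto h ?_
  filter_upwards [Ioo_mem_nhdsLT hxy] with t ht
  rw [slope_def_field, hy, sub_zero]
  exact div_nonpos_of_nonneg_of_nonpos (hpos t ht).le (sub_nonpos.2 ht.2.le)

/-- The Wronskian argument in Sturm's comparison theorem: of two solutions with ordered
potentials, the one with the larger potential cannot be positive between two zeros of
the other. -/
theorem sturm_not_pos_of_pos {p q f f' g g' : ℝ → ℝ} (hpq : ∀ t, p t < q t)
    (hf : ∀ t, HasDerivAt f (f' t) t) (hf' : ∀ t, HasDerivAt f' (-(p t * f t)) t)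
    (hg : ∀ t, HasDerivAt g (g' t) t) (hg' : ∀ t, HasDerivAt g' (-(q t * g t)) t)
    {x y : ℝ} (hxy : x < y) (hx : f x = 0) (hy : f y = 0)
    (hfpos : ∀ t ∈ Set.Ioo x y, 0 < f t) (hgpos : ∀ t ∈ Set.Ioo x y, 0 < g t) : False := by
  have hW (t : ℝ) : HasDerivAt (fun t => f' t * g t - f t * g' t)
      ((q t - p t) * (f t * g t)) t := by
    refine (((hf' t).mul (hg t)).sub ((hf t).mul (hg' t))).congr_deriv ?_
    ring
  have hmono := strictMonoOn_of_deriv_pos (convex_Icc x y)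
    (fun t _ => (hW t).continuousAt.continuousWithinAt) (fun t ht => by
      rw [interior_Icc] at ht
      rw [(hW t).deriv]
      exact mul_pos (sub_pos.2 (hpq t)) (mul_pos (hfpos t ht) (hgpos t ht)))
  have hlt := hmono (Set.left_mem_Icc.2 hxy.le) (Set.right_mem_Icc.2 hxy.le) hxy
  have hgnn : ∀ t ∈ Set.Icc x y, 0 ≤ g t := by
    have hcl : Set.Icc x y ⊆ closure (Set.Ioo x y) := (closure_Ioo hxy.ne).ge
    have hgc : Continuous g := continuous_iff_continuousAt.2 fun t => (hg t).continuousAt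
    exact fun t ht => closure_minimal (fun s hs => (hgpos s hs).le)
      (isClosed_le continuous_const hgc) (hcl ht)
  have h1 := mul_nonneg ((hf x).nonneg_of_pos_right hxy hx hfpos)
    (hgnn x (Set.left_mem_Icc.2 hxy.le))
  have h2 := mul_nonpos_of_nonpos_of_nonneg ((hf y).nonpos_of_pos_left hxy hy hfpos)
    (hgnn y (Set.right_mem_Icc.2 hxy.le))
  simp only [hx, hy] at hlt
  linarith

/-- A continuous function without zeros on an open interval has constant sign there. -/
theorem ContinuousOn.pos_or_neg_of_ne_zero {f : ℝ → ℝ} {x y : ℝ}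
    (hf : ContinuousOn f (Set.Ioo x y)) (hne : ∀ t ∈ Set.Ioo x y, f t ≠ 0) :
    (∀ t ∈ Set.Ioo x y, 0 < f t) ∨ ∀ t ∈ Set.Ioo x y, 0 < -f t := by
  by_contra! h
  obtain ⟨⟨s, hs, hfs⟩, t, ht, hft⟩ := h
  obtain ⟨u, hu, hfu⟩ := isPreconnected_Ioo.intermediate_value hs ht hf
    (show (0 : ℝ) ∈ Set.Icc (f s) (f t) from ⟨hfs, by linarith⟩)
  exact hne u hu hfu

/-- Sturm's comparison theorem: strictly between consecutive zeros of a solution there is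
a zero of any solution for a strictly larger potential. -/
theorem sturm_exists_zero {p q f f' g g' : ℝ → ℝ} (hpq : ∀ t, p t < q t)
    (hf : ∀ t, HasDerivAt f (f' t) t) (hf' : ∀ t, HasDerivAt f' (-(p t * f t)) t)
    (hg : ∀ t, HasDerivAt g (g' t) t) (hg' : ∀ t, HasDerivAt g' (-(q t * g t)) t)
    {x y : ℝ} (hxy : x < y) (hx : f x = 0) (hy : f y = 0)
    (hne : ∀ t ∈ Set.Ioo x y, f t ≠ 0) : ∃ t ∈ Set.Ioo x y, g t = 0 := by
  by_contra! hgne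
  have nf' (t : ℝ) : HasDerivAt (fun t => -f' t) (-(p t * -f t)) t :=
    (hf' t).fun_neg.congr_deriv (by ring)
  have ng' (t : ℝ) : HasDerivAt (fun t => -g' t) (-(q t * -g t)) t :=
    (hg' t).fun_neg.congr_deriv (by ring)
  have hnx : -f x = 0 := by rw [hx, neg_zero]
  have hny : -f y = 0 := by rw [hy, neg_zero]
  rcases ContinuousOn.pos_or_neg_of_ne_zero
      (fun t _ => (hf t).continuousAt.continuousWithinAt) hne with h1 | h1 <;>
    rcases ContinuousOn.pos_or_neg_of_ne_zero
      (fun t _ => (hg t).continuousAt.continuousWithinAt) hgne with h2 | h2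
  · exact sturm_not_pos_of_pos hpq hf hf' hg hg' hxy hx hy h1 h2
  · exact sturm_not_pos_of_pos hpq hf hf' (fun t => (hg t).fun_neg) ng' hxy hx hy h1 h2
  · exact sturm_not_pos_of_pos hpq (fun t => (hf t).fun_neg) nf' hg hg' hxy hnx hny h1 h2
  · exact sturm_not_pos_of_pos hpq (fun t => (hf t).fun_neg) nf' (fun t => (hg t).fun_neg) ng'
      hxy hnx hny h1 h2

/-- A continuous periodic function on the line is bounded. -/
theorem exists_abs_le_of_continuous_periodic {V : ℝ → ℝ} {a : ℝ} (ha : 0 < a)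
    (hV : Continuous V) (hper : Function.Periodic V a) : ∃ M, ∀ t, |V t| ≤ M := by
  obtain ⟨M, hM⟩ := isCompact_Icc.exists_bound_of_continuousOn (s := Set.Icc 0 a) hV.continuousOn
  refine ⟨M, fun t => ?_⟩
  obtain ⟨s, hs, hst⟩ := hper.exists_mem_Ico₀ ha t
  rw [hst]
  exact hM s (Set.Ico_subset_Icc_self hs)

namespace IsPeriodicEigenfunction

variable {a lam : ℝ} {V f : ℝ → ℝ}

theorem hasDerivAt (hf : IsPeriodicEigenfunction a V lam f) (t : ℝ) :
    HasDerivAt f (deriv f t) t :=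
  (hf.1.differentiable (by simp) t).hasDerivAt

theorem hasDerivAt_deriv (hf : IsPeriodicEigenfunction a V lam f) (t : ℝ) :
    HasDerivAt (deriv f) (-((V t + lam) * f t)) t := by
  have h : ContDiff ℝ (⊤ : ℕ∞) (deriv f) := (contDiff_infty_iff_deriv.1 hf.1).2
  have := (h.differentiable (by simp) t).hasDerivAt
  rwa [eq_neg_of_add_eq_zero_left (hf.2.2.1 t)] at this

/-- Zeros of an eigenfunction are simple. -/
theorem deriv_ne_zero (hf : IsPeriodicEigenfunction a V lam f) {M : ℝ}
    (hM : ∀ t, |V t + lam| ≤ M) {t : ℝ} (ht : f t = 0) : deriv f t ≠ 0 := fun h =>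
  hf.2.1 (funext fun s =>
    eq_zero_of_linear_ode_of_cauchy_data hM hf.hasDerivAt hf.hasDerivAt_deriv ht h s)

/-- An eigenfunction of an even potential vanishing at `0` is odd. -/
theorem odd_of_apply_zero (hf : IsPeriodicEigenfunction a V lam f) {M : ℝ}
    (hM : ∀ t, |V t + lam| ≤ M) (hV : ∀ t, V (-t) = V t) (h0 : f 0 = 0) (t : ℝ) :
    f (-t) = -f t := by
  have hneg (t : ℝ) : HasDerivAt (fun t : ℝ => -t) (-1) t := hasDerivAt_neg t
  have h1 (t : ℝ) : HasDerivAt (fun t => f (-t) + f t) (-deriv f (-t) + deriv f t) t :=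
    (((hf.hasDerivAt (-t)).comp t (hneg t)).add (hf.hasDerivAt t)).congr_deriv (by ring)
  have h2 (t : ℝ) : HasDerivAt (fun t => -deriv f (-t) + deriv f t)
      (-((V t + lam) * (f (-t) + f t))) t :=
    (((hf.hasDerivAt_deriv (-t)).comp t (hneg t)).neg.add (hf.hasDerivAt_deriv t)).congr_deriv
      (by rw [hV]; ring)
  have := eq_zero_of_linear_ode_of_cauchy_data hM h1 h2 (t₀ := 0) (by simp [h0]) (by simp) t
  linarith

/-- An odd periodic function vanishes at the half period. -/
theorem apply_half_period (hf : IsPeriodicEigenfunction a V lam f) {M : ℝ}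
    (hM : ∀ t, |V t + lam| ≤ M) (hV : ∀ t, V (-t) = V t) (h0 : f 0 = 0) : f (a / 2) = 0 := by
  have h1 := hf.odd_of_apply_zero hM hV h0 (a / 2)
  have h2 := hf.2.2.2 (-(a / 2))
  rw [show -(a / 2) + a = a / 2 by ring] at h2
  linarith

theorem finite_zeros (hf : IsPeriodicEigenfunction a V lam f) {M : ℝ}
    (hM : ∀ t, |V t + lam| ≤ M) (x y : ℝ) : {t | t ∈ Set.Icc x y ∧ f t = 0}.Finite := by
  by_contra hinf
  obtain ⟨t, -, ht⟩ := Set.Infinite.exists_accPt_of_subset_isCompact hinf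
    (isCompact_Icc (a := x) (b := y)) fun _ h => h.1
  have hfreq : ∃ᶠ s in 𝓝[≠] t, f s = 0 :=
    (accPt_iff_frequently_nhdsNE.1 ht).mono fun _ h => h.2
  have hft : f t = 0 := by
    have hcl : IsClosed {s | f s = 0} := isClosed_eq hf.1.continuous continuous_const
    exact hcl.mem_of_frequently_of_tendsto hfreq (tendsto_id.mono_left nhdsWithin_le_nhds)
  exact hfreq ((hf.hasDerivAt t).eventually_ne (hf.deriv_ne_zero hM hft))

end IsPeriodicEigenfunction

/-- For `V` real-analytic, `a`-periodic and even: if `f`, `g` are periodic eigenfunctions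
for eigenvalues `lam < μ`, both vanishing at `0` (hence both odd), and `f` has `n` zeros
and `g` has `m` zeros in `[0,a)`, then `m ≥ n + 2`. -/
theorem odd_eigenfunctions_node_gap (a : ℝ) (ha : 0 < a) (V : ℝ → ℝ)
    (hV : AnalyticOnNhd ℝ V Set.univ) (hVper : ∀ x : ℝ, V (x + a) = V x)
    (hVeven : ∀ x : ℝ, V (-x) = V x) (lam μ : ℝ) (hlt : lam < μ) (f g : ℝ → ℝ)
    (hf : IsPeriodicEigenfunction a V lam f) (hg : IsPeriodicEigenfunction a V μ g)
    (hf0 : f 0 = 0) (hg0 : g 0 = 0) (n m : ℕ)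
    (hn : {x : ℝ | x ∈ Set.Ico 0 a ∧ f x = 0}.ncard = n)
    (hm : {x : ℝ | x ∈ Set.Ico 0 a ∧ g x = 0}.ncard = m) :
    n + 2 ≤ m := by
  have hVc : Continuous V := continuousOn_univ.1 hV.continuousOn
  have hbd (c : ℝ) : ∃ M, ∀ t, |V t + c| ≤ M :=
    exists_abs_le_of_continuous_periodic ha (hVc.add continuous_const) fun t => by
      simp only [hVper]
  obtain ⟨M, hM⟩ := hbd lam
  obtain ⟨N, hN⟩ := hbd μ
  have hfa : f a = 0 := by simpa [hf0] using hf.2.2.2 0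
  have hgfin : {x : ℝ | x ∈ Set.Ico 0 a ∧ g x = 0}.Finite :=
    (hg.finite_zeros hN 0 a).subset fun x h => ⟨Set.Ico_subset_Icc_self h.1, h.2⟩
  have hgap : ∀ x ∈ {x : ℝ | x ∈ Set.Ico 0 a ∧ f x = 0}, ∃ z, (z ∈ Set.Ico 0 a ∧ g z = 0) ∧
      f z ≠ 0 ∧ x < z ∧ ∀ y ∈ Set.Ico 0 a, f y = 0 → x < y → z < y := by
    rintro x ⟨hx, hfx⟩
    have hfin : {t | t ∈ Set.Ioc x a ∧ f t = 0}.Finite :=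
      (hf.finite_zeros hM x a).subset fun t h => ⟨Set.Ioc_subset_Icc_self h.1, h.2⟩
    obtain ⟨y, ⟨hy, hfy⟩, hmin⟩ := Set.exists_min_image _ id hfin ⟨a, ⟨hx.2, le_rfl⟩, hfa⟩
    have hne : ∀ t ∈ Set.Ioo x y, f t ≠ 0 := fun t ht hft =>
      ht.2.not_ge (hmin t ⟨⟨ht.1, ht.2.le.trans hy.2⟩, hft⟩)
    obtain ⟨z, hz, hgz⟩ := sturm_exists_zero (p := fun t => V t + lam) (q := fun t => V t + μ)
      (fun t => by simpa using hlt) hf.hasDerivAt hf.hasDerivAt_deriv hg.hasDerivAt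
      hg.hasDerivAt_deriv hy.1 hfx hfy hne
    exact ⟨z, ⟨⟨hx.1.trans hz.1.le, hz.2.trans_le hy.2⟩, hgz⟩, hne z hz, hz.1,
      fun t ht hft hxt => hz.2.trans_le (hmin t ⟨⟨hxt, ht.2.le⟩, hft⟩)⟩
  choose! φ hφ hφf hφx hφy using hgap
  have hinj : Set.InjOn φ {x : ℝ | x ∈ Set.Ico 0 a ∧ f x = 0} := by
    intro x hx y hy hxy
    rcases lt_trichotomy x y with h | h | h
    · exact absurd hxy ((hφy x hx y hy.1 hy.2 h).trans (hφx y hy)).ne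
    · exact h
    · exact absurd hxy ((hφy y hy x hx.1 hx.2 h).trans (hφx x hx)).ne'
  have hhalf : a / 2 ∈ Set.Ico 0 a := ⟨by positivity, by linarith⟩
  have hsub : φ '' {x : ℝ | x ∈ Set.Ico 0 a ∧ f x = 0} ∪ {0, a / 2} ⊆
      {x : ℝ | x ∈ Set.Ico 0 a ∧ g x = 0} := by
    rintro z (⟨x, hx, rfl⟩ | rfl | rfl)
    · exact hφ x hx
    · exact ⟨⟨le_rfl, ha⟩, hg0⟩
    · exact ⟨hhalf, hg.apply_half_period hN hVeven hg0⟩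
  have hdisj : Disjoint (φ '' {x : ℝ | x ∈ Set.Ico 0 a ∧ f x = 0}) {0, a / 2} := by
    rw [Set.disjoint_left]
    rintro _ ⟨x, hx, rfl⟩ (h | h)
    · exact hφf x hx (h ▸ hf0)
    · exact hφf x hx (h ▸ hf.apply_half_period hM hVeven hf0)
  have hcard := Set.ncard_le_ncard hsub hgfin
  rwa [Set.ncard_union_eq hdisj (hgfin.subset (Set.subset_union_left.trans hsub)),
    hinj.ncard_image, Set.ncard_pair (by positivity), hn, hm] at hcard
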